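/- arXiv:2012.11530 — 4 statements merged into one kernel-verified Lean document; each statement's English description precedes it below -/
import Mathlib

section
/- Let I be an arbitrary index set and let μ be a probability measure on ℝ^I equipped with the product σ-algebra ⊗_{i∈I} 𝓑(ℝ), with one-dimensional marginal distributions μ_i for i ∈ I. Then there exists a copula measure C on ℝ^I such that for every finite subset J ⊆ I and all (x_j)_{j∈J} ∈ ℝ^J one has F_{C_J}((F_{μ_j}(x_j))_{j∈J}) = F_{μ_J}((x_j)_{j∈J}). Moreover, if the cumulative distribution function F_{μ_i} is continuous for every i ∈ I, then this copula measure C is unique. -/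
open MeasureTheory ProbabilityTheory

/-- The uniform probability measure on `[0,1]`. -/
noncomputable def unif01 : Measure ℝ := (volume : Measure ℝ).restrict (Set.Icc 0 1)

/-- A copula measure on `ℝ^I`: a probability measure on the product σ-algebra all of whose
one-dimensional marginals are uniform on `[0,1]`. -/
def IsCopulaMeasure {I : Type*} (C : Measure (I → ℝ)) : Prop :=
  IsProbabilityMeasure C ∧ ∀ i : I, C.map (fun ω => ω i) = unif01

/-- The Sklar relation: for every finite `J ⊆ I` and every point `x`, the finite-dimensional
cdf of `C` evaluated at the marginal cdfs of `μ` equals the finite-dimensional cdf of `μ`. -/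
def SklarRel {I : Type*} (C μ : Measure (I → ℝ)) : Prop :=
  ∀ (J : Finset I) (x : I → ℝ),
    C {u | ∀ j ∈ J, u j ≤ cdf (μ.map (fun ω => ω j)) (x j)} =
      μ {ω | ∀ j ∈ J, ω j ≤ x j}


section aux
open Set Filter Topology

lemma unif01_Iic (a : ℝ) : unif01 (Iic a) = ENNReal.ofReal (min a 1) := by
  rw [unif01, Measure.restrict_apply measurableSet_Iic]
  have : Iic a ∩ Icc (0:ℝ) 1 = Icc 0 (min a 1) := by
    ext x; simp only [mem_inter_iff, mem_Iic, mem_Icc, le_min_iff]; tauto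
  rw [this, Real.volume_Icc, sub_zero]

instance unif01_prob : IsProbabilityMeasure unif01 :=
  ⟨by simp [unif01]⟩

lemma unif01_ae : ∀ᵐ v ∂unif01, v ∈ Icc (0:ℝ) 1 :=
  ae_restrict_mem measurableSet_Icc

lemma unif01_slice (p s : ℝ) (hs : 0 ≤ s) (hsp : s ≤ p) :
    ENNReal.ofReal p * unif01 {v | p * v ≤ s} = ENNReal.ofReal s := by
  rcases (hs.trans hsp).eq_or_lt with h | h
  · have : s = 0 := by linarith
    simp [← h, this]
  · have : {v | p * v ≤ s} = Iic (s / p) := by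
      ext v; simp [le_div_iff₀ h, mul_comm]
    rw [this, unif01_Iic, min_eq_left ((div_le_one h).2 hsp), ← ENNReal.ofReal_mul h.le,
      mul_div_cancel₀ _ h.ne']

/-- distributional transform -/
noncomputable def dtr (ν : Measure ℝ) (z : ℝ × ℝ) : ℝ :=
  Function.leftLim (cdf ν) z.1 + (cdf ν z.1 - Function.leftLim (cdf ν) z.1) * z.2

lemma measurable_dtr (ν : Measure ℝ) : Measurable (dtr ν) := by
  have h1 : Measurable (cdf ν) := (monotone_cdf ν).measurable
  have h2 : Measurable (Function.leftLim (cdf ν)) := (monotone_cdf ν).leftLim.measurable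
  unfold dtr
  fun_prop

lemma dtr_le (ν : Measure ℝ) (x v : ℝ) (hv : v ∈ Icc (0:ℝ) 1) : dtr ν (x, v) ≤ cdf ν x := by
  have := (monotone_cdf ν).leftLim_le (le_refl x)
  have := mul_le_of_le_one_right (sub_nonneg.2 this) hv.2
  simp only [dtr]; linarith

lemma le_dtr (ν : Measure ℝ) (x v : ℝ) (hv : v ∈ Icc (0:ℝ) 1) :
    Function.leftLim (cdf ν) x ≤ dtr ν (x, v) := by
  have := (monotone_cdf ν).leftLim_le (le_refl x)
  have := mul_nonneg (sub_nonneg.2 this) hv.1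
  simp only [dtr]; linarith

lemma exists_quantile (ν : Measure ℝ) (u : ℝ) (h0 : 0 < u) (h1 : u < 1) :
    ∃ q, Function.leftLim (cdf ν) q ≤ u ∧ u ≤ cdf ν q := by
  set S := {x | u ≤ cdf ν x} with hS
  have hne : S.Nonempty := by
    obtain ⟨x, hx⟩ := ((tendsto_cdf_atTop ν).eventually (lt_mem_nhds h1)).exists
    exact ⟨x, hx.le⟩
  have hbd : BddBelow S := by
    obtain ⟨x, hx⟩ := ((tendsto_cdf_atBot ν).eventually (gt_mem_nhds h0)).exists
    refine ⟨x, fun y hy => ?_⟩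
    by_contra hlt
    have := monotone_cdf ν (not_le.1 hlt).le
    have hy' : u ≤ cdf ν y := hy
    linarith
  refine ⟨sInf S, ?_, ?_⟩
  · refine le_of_tendsto ((monotone_cdf ν).tendsto_leftLim (sInf S)) ?_
    filter_upwards [self_mem_nhdsWithin] with y hy
    by_contra hlt
    exact absurd (csInf_le hbd (show y ∈ S from (not_le.1 hlt).le)) (not_le.2 hy)
  · have hc : Tendsto (cdf ν) (𝓝[>] (sInf S)) (𝓝 (cdf ν (sInf S))) :=
      ((cdf ν).right_continuous (sInf S)).mono_left (nhdsWithin_mono _ Ioi_subset_Ici_self)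
    refine ge_of_tendsto hc ?_
    filter_upwards [self_mem_nhdsWithin] with y hy
    obtain ⟨z, hz, hzy⟩ := exists_lt_of_csInf_lt hne hy
    exact le_trans hz (monotone_cdf ν hzy.le)

lemma cdf_Iio (ν : Measure ℝ) [IsProbabilityMeasure ν] (q : ℝ) :
    ν (Iio q) = ENNReal.ofReal (Function.leftLim (cdf ν) q) := by
  have := (cdf ν).measure_Iio (tendsto_cdf_atBot ν) q
  rwa [measure_cdf, sub_zero] at this

lemma cdf_single (ν : Measure ℝ) [IsProbabilityMeasure ν] (q : ℝ) :
    ν {q} = ENNReal.ofReal (cdf ν q - Function.leftLim (cdf ν) q) := by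
  have := (cdf ν).measure_singleton q
  rwa [measure_cdf] at this

lemma leftLim_cdf_nonneg (ν : Measure ℝ) (q : ℝ) : 0 ≤ Function.leftLim (cdf ν) q :=
  (cdf_nonneg ν (q - 1)).trans ((monotone_cdf ν).le_leftLim (by linarith))

lemma measurableSet_slice (p s : ℝ) : MeasurableSet {v : ℝ | p * v ≤ s} :=
  measurableSet_le (by fun_prop) (by fun_prop)

lemma ae_snd (ν : Measure ℝ) [IsProbabilityMeasure ν] :
    ∀ᵐ z ∂(ν.prod unif01), z.2 ∈ Icc (0:ℝ) 1 :=
  Measure.quasiMeasurePreserving_snd.ae unif01_ae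

lemma dtr_lower (ν : Measure ℝ) [IsProbabilityMeasure ν] (u : ℝ) (h0 : 0 < u) (h1 : u < 1) :
    ENNReal.ofReal u ≤ (ν.prod unif01) {z | dtr ν z ≤ u} := by
  obtain ⟨q, hq1, hq2⟩ := exists_quantile ν u h0 h1
  set a := Function.leftLim (cdf ν) q with ha
  set A : Set (ℝ × ℝ) := Iio q ×ˢ univ with hA
  set B : Set (ℝ × ℝ) := {q} ×ˢ {v | (cdf ν q - a) * v ≤ u - a} with hB
  have hd : Disjoint A B := by
    rw [Set.disjoint_left]
    rintro ⟨x, v⟩ h h'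
    simp only [hA, hB, mem_prod, mem_Iio, mem_singleton_iff] at h h'
    exact absurd h'.1 h.1.ne
  have hAB : (ν.prod unif01) (A ∪ B) = ENNReal.ofReal u := by
    rw [measure_union hd ((measurableSet_singleton q).prod (measurableSet_slice _ _)),
      Measure.prod_prod, Measure.prod_prod, cdf_Iio, cdf_single, ← ha,
      unif01_slice _ _ (by linarith) (by linarith), measure_univ, mul_one,
      ← ENNReal.ofReal_add (leftLim_cdf_nonneg ν q) (by linarith)]
    congr 1; ring
  rw [← hAB]
  refine measure_mono_ae ?_
  filter_upwards [ae_snd ν] with z hz hzAB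
  obtain ⟨x, v⟩ := z
  rcases hzAB with h | h
  · exact (dtr_le ν x v hz).trans (((monotone_cdf ν).le_leftLim h.1).trans hq1)
  · obtain ⟨hx, hv⟩ := h
    simp only [mem_singleton_iff] at hx
    subst hx
    simp only [mem_ofPred_eq] at hv
    change dtr ν (x, v) ≤ u
    simp only [dtr]; linarith

lemma dtr_upper (ν : Measure ℝ) [IsProbabilityMeasure ν] (u : ℝ) (h0 : 0 < u) (h1 : u < 1) :
    (ν.prod unif01) {z | dtr ν z < u} ≤ ENNReal.ofReal u := by
  obtain ⟨q, hq1, hq2⟩ := exists_quantile ν u h0 h1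
  set a := Function.leftLim (cdf ν) q with ha
  set A : Set (ℝ × ℝ) := Iio q ×ˢ univ with hA
  set B : Set (ℝ × ℝ) := {q} ×ˢ {v | (cdf ν q - a) * v ≤ u - a} with hB
  have hAB : (ν.prod unif01) (A ∪ B) ≤ ENNReal.ofReal u := by
    refine (measure_union_le _ _).trans (le_of_eq ?_)
    rw [Measure.prod_prod, Measure.prod_prod, cdf_Iio, cdf_single, ← ha,
      unif01_slice _ _ (by linarith) (by linarith), measure_univ, mul_one,
      ← ENNReal.ofReal_add (leftLim_cdf_nonneg ν q) (by linarith)]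
    congr 1; ring
  refine le_trans ?_ hAB
  refine measure_mono_ae ?_
  filter_upwards [ae_snd ν] with z hz hzu
  obtain ⟨x, v⟩ := z
  change dtr ν (x, v) < u at hzu
  change (x, v) ∈ A ∪ B
  rcases lt_trichotomy x q with h | h | h
  · exact Or.inl ⟨h, trivial⟩
  · subst h
    refine Or.inr ⟨rfl, ?_⟩
    simp only [dtr] at hzu
    simp only [mem_ofPred_eq]; linarith
  · have := le_dtr ν x v hz
    have := (monotone_cdf ν).le_leftLim h
    linarith

lemma map_dtr (ν : Measure ℝ) [IsProbabilityMeasure ν] :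
    (ν.prod unif01).map (dtr ν) = unif01 := by
  have := Measure.isProbabilityMeasure_map (μ := ν.prod unif01) (measurable_dtr ν).aemeasurable
  refine Measure.ext_of_Iic _ _ fun u => ?_
  rw [Measure.map_apply (measurable_dtr ν) measurableSet_Iic, unif01_Iic]
  change (ν.prod unif01) {z | dtr ν z ≤ u} = _
  rcases le_or_gt 1 u with h1 | h1
  · rw [min_eq_right h1, ENNReal.ofReal_one, ← measure_univ (μ := ν.prod unif01)]
    refine measure_congr ?_
    rw [eventuallyEq_univ]
    filter_upwards [ae_snd ν] with z hz
    exact (dtr_le ν z.1 z.2 hz).trans ((cdf_le_one ν _).trans h1)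
  · rw [min_eq_left h1.le]
    apply le_antisymm
    · have hm : ENNReal.ofReal u = ENNReal.ofReal (max u 0) := by
        rcases le_total u 0 with h | h
        · simp [h, ENNReal.ofReal_of_nonpos h]
        · simp [h]
      rw [hm]
      have ht : Tendsto ENNReal.ofReal (𝓝[>] (max u 0)) (𝓝 (ENNReal.ofReal (max u 0))) :=
        (ENNReal.continuous_ofReal.tendsto _).mono_left nhdsWithin_le_nhds
      refine ge_of_tendsto ht ?_
      filter_upwards [Ioo_mem_nhdsGT (show max u 0 < 1 from max_lt h1 one_pos)] with w hw
      have h2 := max_lt_iff.1 hw.1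
      exact (measure_mono fun z (hz : dtr ν z ≤ u) => lt_of_le_of_lt hz h2.1).trans
        (dtr_upper ν w h2.2 hw.2)
    · rcases le_or_gt u 0 with h | h
      · simp [ENNReal.ofReal_of_nonpos h]
      · exact dtr_lower ν u h h1

lemma dtr_ae_iff (ν : Measure ℝ) [IsProbabilityMeasure ν] (x : ℝ) :
    ∀ᵐ z ∂(ν.prod unif01), (dtr ν z ≤ cdf ν x ↔ z.1 ≤ x) := by
  have hB : MeasurableSet {z | dtr ν z ≤ cdf ν x} :=
    measurableSet_le (measurable_dtr ν) measurable_const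
  have hA : MeasurableSet {z : ℝ × ℝ | z.1 ≤ x} :=
    measurableSet_le measurable_fst measurable_const
  have e1 : (ν.prod unif01) {z | dtr ν z ≤ cdf ν x} = ENNReal.ofReal (cdf ν x) := by
    have := unif01_Iic (cdf ν x)
    rw [← map_dtr ν, Measure.map_apply (measurable_dtr ν) measurableSet_Iic,
      min_eq_left (cdf_le_one ν x)] at this
    exact this
  have e2 : (ν.prod unif01) {z : ℝ × ℝ | z.1 ≤ x} = ENNReal.ofReal (cdf ν x) := by
    have : {z : ℝ × ℝ | z.1 ≤ x} = Iic x ×ˢ univ := by ext z; simp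
    rw [this, Measure.prod_prod, measure_univ, mul_one, ofReal_cdf]
  have hle : {z : ℝ × ℝ | z.1 ≤ x} ≤ᵐ[ν.prod unif01] {z | dtr ν z ≤ cdf ν x} := by
    filter_upwards [ae_snd ν] with z hz hzx
    exact (dtr_le ν z.1 z.2 hz).trans (monotone_cdf ν hzx)
  have := ae_eq_of_ae_subset_of_measure_ge hle (by rw [e1, e2]) hA.nullMeasurableSet
    (measure_ne_top _ _)
  filter_upwards [this] with z hz
  exact (iff_of_eq hz).symm

lemma copula_box {I : Type*} (μ C₁ C₂ : Measure (I → ℝ)) [IsProbabilityMeasure μ]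
    (hc : ∀ i : I, Continuous fun x => cdf (μ.map (fun ω => ω i)) x)
    (h₁ : IsCopulaMeasure C₁) (s₁ : SklarRel C₁ μ) (h₂ : IsCopulaMeasure C₂)
    (s₂ : SklarRel C₂ μ) (J : Finset I) (a : I → ℝ) :
    C₁ {u | ∀ j ∈ J, u j ≤ a j} = C₂ {u | ∀ j ∈ J, u j ≤ a j} := by
  classical
  by_cases h0 : ∃ j ∈ J, a j ≤ 0
  · obtain ⟨j, hj, haj⟩ := h0
    have key : ∀ C : Measure (I → ℝ), IsCopulaMeasure C → C {u | ∀ j ∈ J, u j ≤ a j} = 0 := by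
      intro C hC
      have h := unif01_Iic (a j)
      rw [← hC.2 j, Measure.map_apply (measurable_pi_apply j) measurableSet_Iic,
        min_eq_left (by linarith), ENNReal.ofReal_of_nonpos haj] at h
      exact measure_mono_null (fun u hu => hu j hj) h
    rw [key _ h₁, key _ h₂]
  · push Not at h0
    have key : ∀ C : Measure (I → ℝ), IsCopulaMeasure C → C {u | ∀ j ∈ J, u j ≤ a j} =
        C {u | ∀ j ∈ J.filter (fun j => a j < 1), u j ≤ a j} := by
      intro C hC
      have hae : ∀ᵐ u ∂C, ∀ j ∈ J, u j ≤ 1 := by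
        rw [Finset.eventually_all]
        intro j _
        have h := unif01_ae
        rw [← hC.2 j] at h
        filter_upwards [ae_of_ae_map (measurable_pi_apply j).aemeasurable h] with u hu
        exact hu.2
      refine measure_congr ?_
      filter_upwards [hae] with u hu
      refine propext ⟨fun h j hj => h j (Finset.mem_filter.1 hj).1, fun h j hj => ?_⟩
      rcases lt_or_ge (a j) 1 with h1 | h1
      · exact h j (Finset.mem_filter.2 ⟨hj, h1⟩)
      · exact (hu j hj).trans h1
    rw [key _ h₁, key _ h₂]
    have hx : ∀ j, ∃ x, j ∈ J.filter (fun j => a j < 1) →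
        cdf (μ.map (fun ω => ω j)) x = a j := by
      intro j
      by_cases hj : j ∈ J.filter (fun j => a j < 1)
      · have hj' := Finset.mem_filter.1 hj
        obtain ⟨x, hx⟩ := ((tendsto_cdf_atBot (μ.map (fun ω => ω j))).eventually
          (gt_mem_nhds (h0 j hj'.1))).exists
        obtain ⟨y, hy⟩ := ((tendsto_cdf_atTop (μ.map (fun ω => ω j))).eventually
          (lt_mem_nhds hj'.2)).exists
        obtain ⟨z, hz⟩ := mem_range_of_exists_le_of_exists_ge (hc j) ⟨x, hx.le⟩ ⟨y, hy.le⟩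
        exact ⟨z, fun _ => hz⟩
      · exact ⟨0, fun h => absurd h hj⟩
    choose x hx using hx
    have e : {u : I → ℝ | ∀ j ∈ J.filter (fun j => a j < 1), u j ≤ a j} =
        {u | ∀ j ∈ J.filter (fun j => a j < 1), u j ≤ cdf (μ.map (fun ω => ω j)) (x j)} := by
      ext u
      exact forall₂_congr fun j hj => by rw [hx j hj]
    rw [e, s₁, s₂]

lemma ext_of_boxes {I : Type*} (C₁ C₂ : Measure (I → ℝ)) [IsProbabilityMeasure C₁]
    [IsProbabilityMeasure C₂]
    (h : ∀ (J : Finset I) (a : I → ℝ),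
      C₁ {u | ∀ j ∈ J, u j ≤ a j} = C₂ {u | ∀ j ∈ J, u j ≤ a j}) : C₁ = C₂ := by
  classical
  let π : I → Set (Set (I → ℝ)) := fun i => preimage (fun ω : I → ℝ => ω i) '' range Iic
  refine ext_of_generate_finite (piiUnionInter π univ) ?_
    (isPiSystem_piiUnionInter π (fun i => ?_) univ) ?_ (by simp)
  · apply le_antisymm
    · refine iSup_le fun i => ?_
      refine le_trans (le_of_eq ?_) (le_generateFrom_piiUnionInter (π := π) univ (mem_univ i))
      rw [BorelSpace.measurable_eq (α := ℝ), borel_eq_generateFrom_Iic,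
        MeasurableSpace.comap_generateFrom]
    · refine generateFrom_piiUnionInter_le π (fun i => ?_) univ
      refine MeasurableSpace.generateFrom_le ?_
      rintro _ ⟨_, ⟨b, rfl⟩, rfl⟩
      exact measurable_pi_apply i measurableSet_Iic
  · rintro _ ⟨_, ⟨b, rfl⟩, rfl⟩ _ ⟨_, ⟨c, rfl⟩, rfl⟩ _
    exact ⟨Iic (b ⊓ c), ⟨_, rfl⟩, by rw [← preimage_inter, Iic_inter_Iic]⟩
  · rintro _ ⟨J, _, f, hf, rfl⟩
    have : ∀ j, ∃ b : ℝ, j ∈ J → f j = {u | u j ≤ b} := by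
      intro j
      by_cases hj : j ∈ J
      · obtain ⟨_, ⟨b, rfl⟩, hb⟩ := hf j hj
        exact ⟨b, fun _ => hb.symm⟩
      · exact ⟨0, fun h => absurd h hj⟩
    choose b hb using this
    have e : ⋂ x ∈ J, f x = {u | ∀ j ∈ J, u j ≤ b j} := by
      ext u
      simp only [mem_iInter, mem_ofPred_eq]
      exact forall₂_congr fun j hj => by rw [hb j hj]; rfl
    rw [e]
    exact h J b

end aux

/-- **Sklar's theorem in arbitrary dimensions, first part.**
Every probability measure `μ` on `ℝ^I` possesses an underlying copula measure `C`, i.e. a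
copula satisfying the Sklar relation with `μ`; and if all the one-dimensional marginal cdfs
of `μ` are continuous, then this copula measure is unique. -/
theorem sklar_infinite_dimensions_part_one {I : Type*} (μ : Measure (I → ℝ))
    [IsProbabilityMeasure μ] :
    (∃ C : Measure (I → ℝ), IsCopulaMeasure C ∧ SklarRel C μ) ∧
      ((∀ i : I, Continuous fun x => cdf (μ.map (fun ω => ω i)) x) →
        ∀ C₁ C₂ : Measure (I → ℝ), IsCopulaMeasure C₁ → SklarRel C₁ μ →
          IsCopulaMeasure C₂ → SklarRel C₂ μ → C₁ = C₂) := by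
  open Set in
  refine ⟨?_, fun hc C₁ C₂ h₁ s₁ h₂ s₂ => ?_⟩
  · let ν : I → Measure ℝ := fun i => μ.map (fun ω => ω i)
    have hν : ∀ i, IsProbabilityMeasure (ν i) := fun i =>
      Measure.isProbabilityMeasure_map (measurable_pi_apply i).aemeasurable
    let g : I → (I → ℝ) × ℝ → ℝ × ℝ := fun i => Prod.map (fun ω => ω i) id
    have hg : ∀ i, Measurable (g i) := fun i => (measurable_pi_apply i).prodMap measurable_id
    have hmap : ∀ i, (μ.prod unif01).map (g i) = (ν i).prod unif01 := fun i => by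
      have := Measure.map_prod_map μ unif01 (measurable_pi_apply (X := fun _ : I => ℝ) i)
        measurable_id
      rw [Measure.map_id] at this
      exact this.symm
    let T : (I → ℝ) × ℝ → I → ℝ := fun z i => dtr (ν i) (g i z)
    have hT : Measurable T := measurable_pi_lambda _ fun i => (measurable_dtr (ν i)).comp (hg i)
    refine ⟨(μ.prod unif01).map T,
      ⟨Measure.isProbabilityMeasure_map hT.aemeasurable, fun i => ?_⟩, fun J x => ?_⟩
    · have h := map_dtr (ν i)
      rw [← hmap i, Measure.map_map (measurable_dtr (ν i)) (hg i)] at h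
      rw [Measure.map_map (measurable_pi_apply i) hT]
      exact h
    · have hmeas : MeasurableSet {u : I → ℝ | ∀ j ∈ J, u j ≤ cdf (ν j) (x j)} := by
        have : {u : I → ℝ | ∀ j ∈ J, u j ≤ cdf (ν j) (x j)} =
            ⋂ j ∈ J, {u | u j ≤ cdf (ν j) (x j)} := by ext; simp
        rw [this]
        exact Finset.measurableSet_biInter _ fun j _ =>
          measurableSet_le (measurable_pi_apply j) measurable_const
      change (μ.prod unif01).map T {u : I → ℝ | ∀ j ∈ J, u j ≤ cdf (ν j) (x j)} = _
      rw [Measure.map_apply hT hmeas]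
      have e : (μ.prod unif01) ({ω | ∀ j ∈ J, ω j ≤ x j} ×ˢ univ) =
          μ {ω | ∀ j ∈ J, ω j ≤ x j} := by
        rw [Measure.prod_prod, measure_univ, mul_one]
      rw [← e]
      have hae : ∀ᵐ z ∂(μ.prod unif01), ∀ j ∈ J,
          (dtr (ν j) (g j z) ≤ cdf (ν j) (x j) ↔ (g j z).1 ≤ x j) := by
        rw [Finset.eventually_all]
        intro j _
        have h := dtr_ae_iff (ν j) (x j)
        rw [← hmap j] at h
        exact ae_of_ae_map (hg j).aemeasurable h
      refine measure_congr ?_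
      filter_upwards [hae] with z hz
      refine propext ⟨fun h => ⟨fun j hj => (hz j hj).1 (h j hj), trivial⟩,
        fun h j hj => (hz j hj).2 (h.1 j hj)⟩
  · have := h₁.1
    have := h₂.1
    exact ext_of_boxes C₁ C₂ (copula_box μ C₁ C₂ hc h₁ s₁ h₂ s₂)
end

section
/- Let I be an arbitrary index set, let C be a copula measure on ℝ^I, and let (μ_i)_{i∈I} be a collection of Borel probability measures on ℝ. Then there exists a unique probability measure μ on the product σ-algebra ⊗_{i∈I} 𝓑(ℝ) such that for every finite J ⊆ I and all (x_j)_{j∈J} ∈ ℝ^J one has F_{C_J}((F_{μ_j}(x_j))_{j∈J}) = F_{μ_J}((x_j)_{j∈J}); explicitly, μ is the pushforward of C under the map [0,1]^I → ℝ^I, (u_i)_{i∈I} ↦ (F_{μ_i}^{[-1]}(u_i))_{i∈I}. -/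
open MeasureTheory ProbabilityTheory

/-- The quantile function `F_ν^{[-1]}(u) = inf {x : F_ν(x) ≥ u}` of a measure `ν` on `ℝ`. -/
noncomputable def quantileFn (ν : Measure ℝ) (u : ℝ) : ℝ := sInf {x : ℝ | u ≤ cdf ν x}

/-- The Sklar relation of a copula `C`, a family of one-dimensional marginals `ν`, and a
measure `μ` on `ℝ^I`: for every finite `J ⊆ I` and point `x`, the finite-dimensional cdf of
`C` at the marginal cdfs `(F_{ν_j}(x_j))` equals the finite-dimensional cdf of `μ` at `x`. -/
def SklarRelWith {I : Type*} (C : Measure (I → ℝ)) (ν : I → Measure ℝ)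
    (μ : Measure (I → ℝ)) : Prop :=
  ∀ (J : Finset I) (x : I → ℝ),
    C {u | ∀ j ∈ J, u j ≤ cdf (ν j) (x j)} = μ {ω | ∀ j ∈ J, ω j ≤ x j}

lemma quantileFn_le_iff (ν : Measure ℝ) {u : ℝ} (hu : u ∈ Set.Ioo (0 : ℝ) 1) (x : ℝ) :
    quantileFn ν u ≤ x ↔ u ≤ cdf ν x := by
  have hbdd : BddBelow {x : ℝ | u ≤ cdf ν x} := by
    have h := (tendsto_cdf_atBot ν).eventually (gt_mem_nhds hu.1)
    obtain ⟨a, ha⟩ := h.exists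
    refine ⟨a, fun y hy => ?_⟩
    by_contra hlt
    have h1 : cdf ν y ≤ cdf ν a := monotone_cdf ν (not_le.mp hlt).le
    have h2 : u ≤ cdf ν y := hy
    linarith
  have hne : {x : ℝ | u ≤ cdf ν x}.Nonempty := by
    have h := (tendsto_cdf_atTop ν).eventually (lt_mem_nhds hu.2)
    obtain ⟨a, ha⟩ := h.exists
    exact ⟨a, ha.le⟩
  constructor
  · intro hq
    have hr : Filter.Tendsto (cdf ν) (nhdsWithin x (Set.Ioi x)) (nhds (cdf ν x)) :=
      ((cdf ν).right_continuous x).mono_left (nhdsWithin_mono _ Set.Ioi_subset_Ici_self)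
    refine ge_of_tendsto hr ?_
    filter_upwards [self_mem_nhdsWithin] with y hy
    obtain ⟨z, hz, hzy⟩ := (csInf_lt_iff hbdd hne).1 (lt_of_le_of_lt hq hy)
    exact le_trans hz (monotone_cdf ν hzy.le)
  · intro h
    exact csInf_le hbdd h

lemma quantileFn_of_nonpos (ν : Measure ℝ) {u : ℝ} (hu : u ≤ 0) : quantileFn ν u = 0 := by
  have : {x : ℝ | u ≤ cdf ν x} = Set.univ :=
    Set.eq_univ_of_forall fun x => le_trans hu (cdf_nonneg ν x)
  simp [quantileFn, this]

lemma quantileFn_of_one_lt (ν : Measure ℝ) {u : ℝ} (hu : 1 < u) : quantileFn ν u = 0 := by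
  have : {x : ℝ | u ≤ cdf ν x} = ∅ :=
    Set.eq_empty_of_forall_notMem fun x hx => absurd (le_trans hx (cdf_le_one ν x)) (not_le.2 hu)
  simp [quantileFn, this]

lemma measurable_quantileFn (ν : Measure ℝ) : Measurable (quantileFn ν) := by
  refine measurable_of_Iic fun x => ?_
  have : quantileFn ν ⁻¹' Set.Iic x = (Set.Ioo 0 1 ∩ Set.Iic (cdf ν x)) ∪
      ({u | u = 1 ∧ quantileFn ν 1 ≤ x} ∪ ({u | u ≤ 0 ∨ 1 < u} ∩ {_u | (0 : ℝ) ≤ x})) := by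
    ext u
    simp only [Set.mem_preimage, Set.mem_Iic, Set.mem_union, Set.mem_inter_iff, Set.mem_ofPred_eq]
    rcases le_or_gt u 0 with h0 | h0
    · have : u ≠ 1 := by linarith
      have h' : ¬ 0 < u := not_lt.2 h0
      simp [quantileFn_of_nonpos ν h0, h0, this, h']
    rcases lt_trichotomy u 1 with h1 | h1 | h1
    · rw [quantileFn_le_iff ν ⟨h0, h1⟩]
      simp [h0, h1, h1.ne, h1.le, not_le.2 h0, not_lt.2 h1.le]
    · subst h1
      simp
    · simp [quantileFn_of_one_lt ν h1, h1, h1.ne', not_lt.2 h1.le]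
  rw [this]
  refine (measurableSet_Ioo.inter measurableSet_Iic).union (MeasurableSet.union ?_ ?_)
  · exact Set.Subsingleton.measurableSet fun a ha b hb => ha.1.trans hb.1.symm
  · exact (measurableSet_Iic.union measurableSet_Ioi).inter (MeasurableSet.const _)

lemma copula_ae_mem_Ioo {I : Type*} {C : Measure (I → ℝ)} (hC : IsCopulaMeasure C) (i : I) :
    ∀ᵐ u ∂C, u i ∈ Set.Ioo (0 : ℝ) 1 := by
  refine ae_of_ae_map (measurable_pi_apply i).aemeasurable
    (f := fun u : I → ℝ => u i)
    (p := fun t : ℝ => t ∈ Set.Ioo (0 : ℝ) 1) ?_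
  rw [hC.2 i, unif01, ← Measure.restrict_congr_set Ioo_ae_eq_Icc]
  exact ae_restrict_mem measurableSet_Ioo

lemma measurable_quantileMap {I : Type*} (ν : I → Measure ℝ) :
    Measurable (fun (u : I → ℝ) i => quantileFn (ν i) (u i)) :=
  measurable_pi_lambda _ fun i => (measurable_quantileFn (ν i)).comp (measurable_pi_apply i)

lemma measurableSet_box {I : Type*} (J : Finset I) (x : I → ℝ) :
    MeasurableSet {ω : I → ℝ | ∀ j ∈ J, ω j ≤ x j} := by
  have : {ω : I → ℝ | ∀ j ∈ J, ω j ≤ x j} = ⋂ j ∈ J, {ω | ω j ≤ x j} := by ext; simp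
  rw [this]
  exact J.measurableSet_biInter fun j _ => measurableSet_le (measurable_pi_apply j) measurable_const

lemma sklarRel_map {I : Type*} {C : Measure (I → ℝ)} (hC : IsCopulaMeasure C)
    (ν : I → Measure ℝ) : SklarRelWith C ν (C.map (fun u i => quantileFn (ν i) (u i))) := by
  intro J x
  rw [Measure.map_apply (measurable_quantileMap ν) (measurableSet_box J x)]
  refine measure_congr ?_
  have h : ∀ᵐ u ∂C, ∀ j ∈ J, u j ∈ Set.Ioo (0 : ℝ) 1 :=
    (Finset.eventually_all J).2 fun j _ => copula_ae_mem_Ioo hC j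
  filter_upwards [h] with u hu
  refine propext ?_
  exact forall₂_congr fun j hj => (quantileFn_le_iff (ν j) (hu j hj) (x j)).symm

lemma eq_of_box {I : Type*} (μ μ' : Measure (I → ℝ)) [IsProbabilityMeasure μ]
    [IsProbabilityMeasure μ']
    (h : ∀ (J : Finset I) (x : I → ℝ),
      μ {ω | ∀ j ∈ J, ω j ≤ x j} = μ' {ω | ∀ j ∈ J, ω j ≤ x j}) : μ = μ' := by
  classical
  refine ext_of_generate_finite
    {s | ∃ (J : Finset I) (x : I → ℝ), s = {ω | ∀ j ∈ J, ω j ≤ x j}} ?_ ?_ ?_ (by simp)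
  · refine le_antisymm ?_ (MeasurableSpace.generateFrom_le ?_)
    · refine iSup_le fun i => ?_
      rw [← measurable_iff_comap_le]
      refine @measurable_of_Iic ℝ (I → ℝ) _ _ _ (_) _ _ _ _ fun a => ?_
      refine MeasurableSpace.measurableSet_generateFrom ⟨{i}, fun _ => a, ?_⟩
      ext ω
      simp
    · rintro s ⟨J, x, rfl⟩
      exact measurableSet_box J x
  · rintro s ⟨J, x, rfl⟩ t ⟨K, y, rfl⟩ -
    refine ⟨J ∪ K, fun i => if i ∈ J then (if i ∈ K then min (x i) (y i) else x i) else y i, ?_⟩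
    ext ω
    simp only [Set.mem_inter_iff, Set.mem_ofPred_eq, Finset.mem_union]
    constructor
    · rintro ⟨h1, h2⟩ j hj
      by_cases hJ : j ∈ J <;> by_cases hK : j ∈ K <;> simp_all
    · intro h
      refine ⟨fun j hJ => ?_, fun j hK => ?_⟩
      · have := h j (Or.inl hJ)
        by_cases hK : j ∈ K <;> simp_all
      · have := h j (Or.inr hK)
        by_cases hJ : j ∈ J <;> simp_all
  · rintro s ⟨J, x, rfl⟩
    exact h J x

/-- **Sklar's theorem in arbitrary dimensions, second part.**
Given a copula measure `C` on `ℝ^I` and a family of Borel probability measures `(ν i)` on `ℝ`,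
there is a unique probability measure `μ` on the product σ-algebra satisfying the Sklar
relation; explicitly, `μ` is the pushforward of `C` under `(u_i) ↦ (F_{ν_i}^{[-1]}(u_i))`. -/
theorem sklar_infinite_dimensions_part_two {I : Type*} (C : Measure (I → ℝ))
    (hC : IsCopulaMeasure C) (ν : I → Measure ℝ) (hν : ∀ i, IsProbabilityMeasure (ν i)) :
    (∃! μ : Measure (I → ℝ), IsProbabilityMeasure μ ∧ SklarRelWith C ν μ) ∧
      IsProbabilityMeasure (C.map (fun u i => quantileFn (ν i) (u i))) ∧
      SklarRelWith C ν (C.map (fun u i => quantileFn (ν i) (u i))) ∧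
      (∀ μ : Measure (I → ℝ), IsProbabilityMeasure μ → SklarRelWith C ν μ →
        μ = C.map (fun u i => quantileFn (ν i) (u i))) := by
  have := hC.1
  have hP : IsProbabilityMeasure (C.map (fun u i => quantileFn (ν i) (u i))) :=
    Measure.isProbabilityMeasure_map (measurable_quantileMap ν).aemeasurable
  have hS := sklarRel_map hC ν
  have hU : ∀ μ : Measure (I → ℝ), IsProbabilityMeasure μ → SklarRelWith C ν μ →
        μ = C.map (fun u i => quantileFn (ν i) (u i)) := fun μ hμ h =>
    eq_of_box _ _ fun J x => (h J x).symm.trans (hS J x)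
  exact ⟨⟨_, ⟨hP, hS⟩, fun μ h => hU μ h.1 h.2⟩, hP, hS, hU⟩
end

section
/- Let T = I_1 × … × I_d ⊂ ℝ^d be an interval and let X = (X_t)_{t∈T} be a stochastic process with almost surely continuous sample paths whose one-dimensional marginal distribution functions F_t (the cdf of X_t) are continuous for every t ∈ T. Then the map (t,x) ↦ F_t(x) is jointly continuous on T × ℝ. If, in addition, each F_t is strictly increasing between the points F_t^{[-1]}(0+) and F_t^{[-1]}(1), then the map (t,u) ↦ F_t^{[-1]}(u) is jointly continuous (on T × (0,1)). -/
open MeasureTheory ProbabilityTheory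

/-- The quantile function `F^{[-1]}(u) = inf {x : F(x) ≥ u}` of a function `F : ℝ → ℝ`. -/
noncomputable def quantileOf (F : ℝ → ℝ) (u : ℝ) : ℝ := sInf {x : ℝ | u ≤ F x}

theorem aux_mem (μ : Measure ℝ) (u : ℝ) (hu : u ∈ Set.Ioo (0:ℝ) 1) :
    (∃ a, cdf μ a < u) ∧ {x : ℝ | u ≤ cdf μ x}.Nonempty := by
  refine ⟨((tendsto_cdf_atBot μ).eventually_lt_const hu.1).exists, ?_⟩
  obtain ⟨b, hb⟩ := ((tendsto_cdf_atTop μ).eventually_const_lt hu.2).exists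
  exact ⟨b, hb.le⟩

theorem aux_lower (μ : Measure ℝ) (u a : ℝ) (h : cdf μ a < u) :
    a ∈ lowerBounds {x : ℝ | u ≤ cdf μ x} := by
  intro x hx
  by_contra! hlt
  have := monotone_cdf μ hlt.le
  have hx' : u ≤ cdf μ x := hx
  linarith

/-- Let `T = I₁ × … × I_d ⊂ ℝ^d` be an interval and let `X = (X_t)_{t ∈ T}` be a stochastic
process with almost surely continuous sample paths whose one-dimensional marginal cdfs
`F_t = F_{X_t}` are continuous for every `t`.  Then `(t,x) ↦ F_t(x)` is jointly continuous;
if moreover each `F_t` is strictly increasing between `F_t^{[-1]}(0+)` and `F_t^{[-1]}(1)`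
(i.e. strictly increasing on `{x : 0 < F_t(x) < 1}`), then `(t,u) ↦ F_t^{[-1]}(u)` is jointly
continuous on `T × (0,1)`. -/
theorem jointly_continuous_marginals_of_continuous_process
    {d : ℕ} (S : Fin d → Set ℝ) (hS : ∀ i, (S i).OrdConnected)
    {Ω : Type*} [MeasurableSpace Ω] (P : Measure Ω) [IsProbabilityMeasure P]
    (X : ↥(Set.univ.pi S) → Ω → ℝ)
    (hXmeas : ∀ t, Measurable (X t))
    (hXcont : ∀ᵐ ω ∂P, Continuous fun t : ↥(Set.univ.pi S) => X t ω)
    (hFcont : ∀ t, Continuous fun x : ℝ => cdf (P.map (X t)) x) :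
    Continuous (fun q : ↥(Set.univ.pi S) × ℝ =>
        cdf (P.map (X q.1)) q.2) ∧
      ((∀ t, StrictMonoOn (fun x : ℝ => cdf (P.map (X t)) x)
          {x : ℝ | 0 < cdf (P.map (X t)) x ∧ cdf (P.map (X t)) x < 1}) →
        ContinuousOn (fun q : ↥(Set.univ.pi S) × ℝ =>
            quantileOf (fun x => cdf (P.map (X q.1)) x) q.2)
          (Set.univ ×ˢ Set.Ioo (0 : ℝ) 1)) := by
  have h1 : Continuous (fun q : ↥(Set.univ.pi S) × ℝ => cdf (P.map (X q.1)) q.2) := by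
    have hprob : ∀ t, IsProbabilityMeasure (P.map (X t)) := fun t =>
      Measure.isProbabilityMeasure_map (hXmeas t).aemeasurable
    have heq : ∀ q : ↥(Set.univ.pi S) × ℝ,
        cdf (P.map (X q.1)) q.2 = (P {ω | X q.1 ω ≤ q.2}).toReal := by
      intro q
      rw [cdf_eq_real, Measure.real, Measure.map_apply (hXmeas _) measurableSet_Iic]
      rfl
    rw [continuous_iff_continuousAt]
    rintro ⟨t, x⟩
    have hnull : ∀ᵐ ω ∂P, X t ω ≠ x := by
      have h0 : (P.map (X t)) {x} = 0 := by
        rw [← measure_cdf (P.map (X t)), StieltjesFunction.measure_singleton,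
          (hFcont t).continuousAt.continuousWithinAt.leftLim_eq]
        simp
      rw [Measure.map_apply (hXmeas t) (measurableSet_singleton x)] at h0
      rw [ae_iff]
      simpa [Set.preimage] using h0
    unfold ContinuousAt
    rw [funext heq]
    refine (ENNReal.tendsto_toReal (measure_ne_top P {ω | X t ω ≤ x})).comp ?_
    refine tendsto_measure_of_ae_tendsto_indicator_of_isFiniteMeasure (nhds (t, x))
      (measurableSet_le (hXmeas _) measurable_const)
      (fun q => measurableSet_le (hXmeas _) measurable_const) ?_
    filter_upwards [hXcont, hnull] with ω hc hne
    have hc1 : Continuous (fun q : ↥(Set.univ.pi S) × ℝ => X q.1 ω) := hc.comp continuous_fst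
    rcases lt_or_gt_of_ne hne with h | h
    · filter_upwards [hc1.continuousAt.eventually_lt continuous_snd.continuousAt
        (show X (t, x).1 ω < (t, x).2 from h)] with q hq
      exact ⟨fun _ => h.le, fun _ => hq.le⟩
    · filter_upwards [continuous_snd.continuousAt.eventually_lt hc1.continuousAt
        (show (t, x).2 < X (t, x).1 ω from h)] with q hq
      exact ⟨fun h' => absurd h' (not_le.mpr hq), fun h' => absurd h' (not_le.mpr h)⟩
  refine ⟨h1, fun hmono => ?_⟩
  rintro ⟨t, u⟩ ⟨-, hu⟩
  have hu : u ∈ Set.Ioo (0:ℝ) 1 := hu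
  rw [ContinuousWithinAt, Metric.tendsto_nhds]
  intro e he
  set x0 := quantileOf (fun x => cdf (P.map (X t)) x) u with hx0
  obtain ⟨⟨a, ha⟩, hne⟩ := aux_mem (P.map (X t)) u hu
  have hlo : cdf (P.map (X t)) (x0 - e / 2) < u := by
    by_contra! h
    have : x0 ≤ x0 - e / 2 := csInf_le ⟨a, aux_lower _ _ _ ha⟩ h
    linarith
  have hhi : u < cdf (P.map (X t)) (x0 + e / 2) := by
    by_contra! h
    obtain ⟨y, hy, hyx⟩ := exists_lt_of_csInf_lt hne
      (show sInf {x : ℝ | u ≤ cdf (P.map (X t)) x} < x0 + e / 2 by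
        change x0 < _
        linarith)
    have hy : u ≤ cdf (P.map (X t)) y := hy
    have hm := monotone_cdf (P.map (X t)) hyx.le
    have hs : cdf (P.map (X t)) y < cdf (P.map (X t)) (x0 + e / 2) :=
      hmono t ⟨by linarith [hu.1], by linarith [hu.2]⟩
        ⟨by linarith [hu.1], by linarith [hu.2]⟩ hyx
    linarith
  have c1 : ∀ c : ℝ, Continuous (fun q : ↥(Set.univ.pi S) × ℝ => cdf (P.map (X q.1)) c) :=
    fun c => h1.comp (continuous_fst.prodMk continuous_const)
  have e1 := (c1 (x0 - e / 2)).continuousAt.eventually_lt continuous_snd.continuousAt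
    (show cdf (P.map (X (t, u).1)) (x0 - e / 2) < (t, u).2 from hlo)
  have e2 := continuous_snd.continuousAt.eventually_lt (c1 (x0 + e / 2)).continuousAt
    (show (t, u).2 < cdf (P.map (X (t, u).1)) (x0 + e / 2) from hhi)
  filter_upwards [nhdsWithin_le_nhds e1, nhdsWithin_le_nhds e2, self_mem_nhdsWithin]
    with q hq1 hq2 hq3
  obtain ⟨-, hne'⟩ := aux_mem (P.map (X q.1)) q.2 hq3.2
  have l1 : x0 - e / 2 ≤ quantileOf (fun x => cdf (P.map (X q.1)) x) q.2 :=
    le_csInf hne' (aux_lower _ _ _ hq1)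
  have l2 : quantileOf (fun x => cdf (P.map (X q.1)) x) q.2 ≤ x0 + e / 2 :=
    csInf_le ⟨_, aux_lower _ _ _ hq1⟩ hq2.le
  rw [Real.dist_eq, abs_lt]
  constructor <;> linarith
end

section
/- Let T = I_1 × … × I_d ⊂ ℝ^d be an interval and let X = (X_t)_{t∈T} be a stochastic process whose sample paths belong almost surely to C(T) and whose marginal distribution functions F_t (the cdf of X_t) are continuous for every t ∈ T. Then the process U = (U_t)_{t∈T} defined by U_t := F_t(X_t) is a copula process (each U_t is uniformly distributed on [0,1]), it is an underlying copula process for X, and its sample paths are almost surely continuous on T. -/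
open MeasureTheory ProbabilityTheory

open Filter Topology in
lemma aux_level (μ : Measure ℝ) [IsProbabilityMeasure μ] (hc : Continuous fun x => cdf μ x) (x : ℝ) :
    μ {y | cdf μ y ≤ cdf μ x} = μ (Set.Iic x) := by
  apply le_antisymm
  · by_cases hb : BddAbove {y | cdf μ y ≤ cdf μ x}
    · have hcl : IsClosed {y | cdf μ y ≤ cdf μ x} := isClosed_le hc continuous_const
      have hm := hcl.csSup_mem (Set.nonempty_of_mem (x := x) (by simp)) hb
      set s := sSup {y | cdf μ y ≤ cdf μ x}
      have h1 : {y | cdf μ y ≤ cdf μ x} ⊆ Set.Iic s := fun y hy => le_csSup hb hy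
      refine (measure_mono h1).trans ?_
      rw [← ofReal_cdf, ← ofReal_cdf]
      exact ENNReal.ofReal_le_ofReal hm
    · rw [← ofReal_cdf]
      have h1 : (1 : ℝ) ≤ cdf μ x := by
        refine le_of_tendsto (tendsto_cdf_atTop μ) (Eventually.of_forall fun y => ?_)
        rw [not_bddAbove_iff] at hb
        obtain ⟨z, hz, hyz⟩ := hb y
        exact (monotone_cdf μ hyz.le).trans hz
      refine prob_le_one.trans ?_
      rw [← ENNReal.ofReal_one]
      exact ENNReal.ofReal_le_ofReal h1
  · exact measure_mono fun y hy => monotone_cdf μ hy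

lemma aux_level_ae (μ : Measure ℝ) [IsProbabilityMeasure μ] (hc : Continuous fun x => cdf μ x)
    (x : ℝ) : ∀ᵐ y ∂μ, (cdf μ y ≤ cdf μ x ↔ y ≤ x) := by
  have h := ae_eq_of_subset_of_measure_ge (μ := μ) (s := Set.Iic x)
    (t := {y | cdf μ y ≤ cdf μ x}) (fun y hy => monotone_cdf μ hy) (aux_level μ hc x).le
    measurableSet_Iic.nullMeasurableSet (measure_ne_top _ _)
  filter_upwards [h] with y hy
  exact (iff_of_eq hy).symm

lemma aux_unif (μ : Measure ℝ) [IsProbabilityMeasure μ] (hc : Continuous fun x => cdf μ x) :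
    μ.map (fun x => cdf μ x) = unif01 := by
  have hp : IsProbabilityMeasure (μ.map (fun x => cdf μ x)) :=
    Measure.isProbabilityMeasure_map hc.measurable.aemeasurable
  have key : ∀ u : ℝ, 0 < u → u < 1 → μ {y | cdf μ y ≤ u} = ENNReal.ofReal u := by
    intro u h0 h1
    obtain ⟨a, ha⟩ := ((tendsto_cdf_atBot μ).eventually (gt_mem_nhds h0)).exists
    obtain ⟨b, hb⟩ := ((tendsto_cdf_atTop μ).eventually (lt_mem_nhds h1)).exists
    obtain ⟨y, hy⟩ := mem_range_of_exists_le_of_exists_ge hc ⟨a, ha.le⟩ ⟨b, hb.le⟩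
    simp only at hy
    rw [← hy, aux_level μ hc, ofReal_cdf]
  refine Measure.ext_of_Iic _ _ fun u => ?_
  rw [Measure.map_apply hc.measurable measurableSet_Iic, unif01,
    Measure.restrict_apply measurableSet_Iic]
  change μ {y | cdf μ y ≤ u} = _
  have hI : 0 ≤ u → u ≤ 1 → Set.Iic u ∩ Set.Icc (0:ℝ) 1 = Set.Icc 0 u := by
    intro h0 h1
    ext z
    simp only [Set.mem_inter_iff, Set.mem_Iic, Set.mem_Icc]
    constructor
    · rintro ⟨a, b, c⟩; exact ⟨b, a⟩
    · rintro ⟨a, b⟩; exact ⟨b, a, b.trans h1⟩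
  rcases lt_trichotomy u 0 with h | h | h
  · have e1 : {y | cdf μ y ≤ u} = ∅ := by
      ext y; simpa using h.trans_le (cdf_nonneg μ y)
    have e2 : Set.Iic u ∩ Set.Icc (0:ℝ) 1 = ∅ := by
      ext z
      simp only [Set.mem_inter_iff, Set.mem_Iic, Set.mem_Icc, Set.mem_empty_iff_false, iff_false]
      rintro ⟨a, b, c⟩; linarith
    rw [e1, e2]; simp
  · subst h
    rw [hI le_rfl zero_le_one]
    simp only [Set.Icc_self, Real.volume_singleton]
    refine le_antisymm (ENNReal.le_of_forall_pos_le_add fun ε hε _ => ?_) (zero_le)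
    have hm : 0 < min (ε : ℝ) (1/2) := lt_min (by exact_mod_cast hε) (by norm_num)
    have := key (min (ε : ℝ) (1/2)) hm ((min_le_right _ _).trans_lt (by norm_num))
    rw [zero_add]
    calc μ {y | cdf μ y ≤ 0} ≤ μ {y | cdf μ y ≤ min (ε : ℝ) (1/2)} :=
          measure_mono fun y (hy : cdf μ y ≤ 0) => hy.trans hm.le
      _ = _ := this
      _ ≤ ENNReal.ofReal ε := ENNReal.ofReal_le_ofReal (min_le_left _ _)
      _ = ε := ENNReal.ofReal_coe_nnreal
  · rcases lt_or_ge u 1 with h1 | h1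
    · rw [hI h.le h1.le, key u h h1]; simp
    · have e1 : {y | cdf μ y ≤ u} = Set.univ := by
        ext y; simpa using (cdf_le_one μ y).trans h1
      have e2 : Set.Iic u ∩ Set.Icc (0:ℝ) 1 = Set.Icc 0 1 := by
        ext z
        simp only [Set.mem_inter_iff, Set.mem_Iic, Set.mem_Icc, and_iff_right_iff_imp]
        rintro ⟨a, b⟩; linarith
      rw [e1, e2]; simp

lemma aux_singleton (μ : Measure ℝ) [IsProbabilityMeasure μ] (hc : Continuous fun x => cdf μ x)
    (x : ℝ) : μ {x} = 0 := by
  conv_lhs => rw [← measure_cdf μ]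
  rw [StieltjesFunction.measure_singleton, ENNReal.ofReal_eq_zero, sub_nonpos]
  have : Filter.Tendsto (fun y => cdf μ y) (nhdsWithin x (Set.Iio x)) (nhds (cdf μ x)) :=
    (hc.tendsto x).mono_left nhdsWithin_le_nhds
  exact (leftLim_eq_of_tendsto this).ge

open Filter Topology in
lemma aux_cont {T : Type*} [TopologicalSpace T] [FirstCountableTopology T]
    {Ω : Type*} [MeasurableSpace Ω] (P : Measure Ω) [IsProbabilityMeasure P]
    (X : T → Ω → ℝ) (hXmeas : ∀ t, Measurable (X t))
    (hXcont : ∀ᵐ ω ∂P, Continuous fun t => X t ω)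
    (hFcont : ∀ t, Continuous fun x : ℝ => cdf (P.map (X t)) x) (x : ℝ) :
    Continuous fun t => cdf (P.map (X t)) x := by
  have hp : ∀ t, IsProbabilityMeasure (P.map (X t)) := fun t =>
    Measure.isProbabilityMeasure_map (hXmeas t).aemeasurable
  have he : ∀ t, cdf (P.map (X t)) x = (P {ω | X t ω ≤ x}).toReal := by
    intro t
    rw [cdf_eq_real, measureReal_def, Measure.map_apply (hXmeas t) measurableSet_Iic]; rfl
  rw [continuous_iff_continuousAt]
  intro t
  simp only [ContinuousAt, he]
  refine (ENNReal.tendsto_toReal (measure_ne_top _ _)).comp ?_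
  refine tendsto_measure_of_ae_tendsto_indicator_of_isFiniteMeasure (𝓝 t)
    (measurableSet_le (hXmeas t) measurable_const)
    (fun s => measurableSet_le (hXmeas s) measurable_const) ?_
  have h0 : ∀ᵐ ω ∂P, X t ω ≠ x := by
    have := aux_singleton (P.map (X t)) (hFcont t) x
    rw [Measure.map_apply (hXmeas t) (measurableSet_singleton x)] at this
    exact measure_eq_zero_iff_ae_notMem.mp this
  filter_upwards [h0, hXcont] with ω h1 h2
  rcases lt_or_gt_of_ne h1 with h | h
  · filter_upwards [(h2.tendsto t).eventually (gt_mem_nhds h)] with s hs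
    exact iff_of_true hs.le h.le
  · filter_upwards [(h2.tendsto t).eventually (lt_mem_nhds h)] with s hs
    exact iff_of_false (not_le.mpr hs) (not_le.mpr h)

/-- Let `T = I₁ × … × I_d ⊂ ℝ^d` be an interval and `X = (X_t)_{t ∈ T}` a stochastic process
with almost surely continuous sample paths and continuous marginal cdfs `F_t`.  Then
`U_t := F_t(X_t)` defines a copula process (each `U_t` is uniform on `[0,1]`), it is an
underlying copula process for `X` (the Sklar relation holds between the finite-dimensional
laws of `U` and those of `X`), and the sample paths of `U` are almost surely continuous. -/
theorem distributional_transform_is_continuous_copula_process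
    {d : ℕ} (S : Fin d → Set ℝ) (hS : ∀ i, (S i).OrdConnected)
    {Ω : Type*} [MeasurableSpace Ω] (P : Measure Ω) [IsProbabilityMeasure P]
    (X : ↥(Set.univ.pi S) → Ω → ℝ)
    (hXmeas : ∀ t, Measurable (X t))
    (hXcont : ∀ᵐ ω ∂P, Continuous fun t : ↥(Set.univ.pi S) => X t ω)
    (hFcont : ∀ t, Continuous fun x : ℝ => cdf (P.map (X t)) x)
    (U : ↥(Set.univ.pi S) → Ω → ℝ)
    (hU : ∀ t ω, U t ω = cdf (P.map (X t)) (X t ω)) :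
    (∀ t, P.map (U t) = unif01) ∧
      (∀ (J : Finset ↥(Set.univ.pi S)) (x : ↥(Set.univ.pi S) → ℝ),
        P {ω | ∀ j ∈ J, U j ω ≤ cdf (P.map (X j)) (x j)} =
          P {ω | ∀ j ∈ J, X j ω ≤ x j}) ∧
      (∀ᵐ ω ∂P, Continuous fun t : ↥(Set.univ.pi S) => U t ω) := by
  have hp : ∀ t, IsProbabilityMeasure (P.map (X t)) := fun t =>
    Measure.isProbabilityMeasure_map (hXmeas t).aemeasurable
  refine ⟨fun t => ?_, fun J x => ?_, ?_⟩
  · rw [← aux_unif (P.map (X t)) (hFcont t), Measure.map_map (hFcont t).measurable (hXmeas t)]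
    congr 1
    exact funext (hU t)
  · have h : ∀ᵐ ω ∂P, ∀ j ∈ J, (U j ω ≤ cdf (P.map (X j)) (x j) ↔ X j ω ≤ x j) := by
      refine (ae_ball_iff J.countable_toSet).mpr fun j _ => ?_
      have := ae_of_ae_map (hXmeas j).aemeasurable (aux_level_ae _ (hFcont j) (x j))
      filter_upwards [this] with ω hω
      rw [hU]; exact hω
    refine measure_congr ?_
    filter_upwards [h] with ω hω
    exact propext (forall₂_congr hω)
  · filter_upwards [hXcont] with ω hω
    have hc := aux_cont P X hXmeas hXcont hFcont
    rw [continuous_iff_continuousAt]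
    intro t
    simp only [ContinuousAt, hU]
    refine tendsto_order.mpr ⟨fun a ha => ?_, fun a ha => ?_⟩
    · have h1 := ((hFcont t).tendsto (X t ω)).eventually (lt_mem_nhds ha)
      obtain ⟨y, hy, hlt⟩ := ((h1.filter_mono (nhdsWithin_le_nhds (s := Set.Iio (X t ω)))).and
        self_mem_nhdsWithin).exists
      filter_upwards [((hc y).tendsto t).eventually (lt_mem_nhds hy),
        (hω.tendsto t).eventually (lt_mem_nhds hlt)] with s h2 h3
      exact h2.trans_le (monotone_cdf _ h3.le)
    · have h1 := ((hFcont t).tendsto (X t ω)).eventually (gt_mem_nhds ha)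
      obtain ⟨y, hy, hlt⟩ := ((h1.filter_mono (nhdsWithin_le_nhds (s := Set.Ioi (X t ω)))).and
        self_mem_nhdsWithin).exists
      filter_upwards [((hc y).tendsto t).eventually (gt_mem_nhds hy),
        (hω.tendsto t).eventually (gt_mem_nhds hlt)] with s h2 h3
      exact (monotone_cdf _ h3.le).trans_lt h2
end
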